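/- arXiv:1204.2441 — 3 statements merged into one kernel-verified Lean document; each statement's English description precedes it below -/
import Mathlib

section
/- Let (W,S) be a Coxeter system with length function ℓ. Let s ∈ S be a simple reflection and let x, y ∈ W be such that ℓ(xs) > ℓ(x) and ℓ(sy) > ℓ(y). Then ℓ(xsy) > ℓ(xy). -/
namespace CoxeterSystem

variable {B W : Type*} [Group W] {M : CoxeterMatrix B} (cs : CoxeterSystem M W)

open Classical in
/-- The action of a simple reflection on signed elements of `W`: it conjugates the element and
flips the sign exactly at the simple reflection itself. -/
noncomputable def signedConjSimple (i : B) : Function.End (W × ZMod 2) :=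
  fun p ↦ (cs.simple i * p.1 * cs.simple i, p.2 + if p.1 = cs.simple i then 1 else 0)

open Classical in
theorem signedConjSimple_mul_pow_apply (i j : B) (m : ℕ) (t : W) (ε : ZMod 2) :
    ((cs.signedConjSimple i * cs.signedConjSimple j) ^ m) (t, ε) =
      ((cs.simple i * cs.simple j) ^ m * t * ((cs.simple i * cs.simple j) ^ m)⁻¹,
        ε + ∑ k ∈ Finset.range (2 * m),
          if (cs.simple i * cs.simple j) ^ k * t = cs.simple j then 1 else 0) := by
  set p := cs.simple i * cs.simple j with hp
  have hconj (k : ℕ) : cs.simple j * p ^ k = (p ^ k)⁻¹ * cs.simple j := by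
    have h : SemiconjBy (cs.simple j) p p⁻¹ := by
      simp [SemiconjBy, hp, mul_assoc]
    simpa [SemiconjBy] using h.pow_right k
  induction m with
  | zero => simp [Function.End.one_def]
  | succ m ih =>
    have hfst : p ^ m * t * (p ^ m)⁻¹ = cs.simple j ↔ p ^ (2 * m) * t = cs.simple j := by
      rw [mul_inv_eq_iff_eq_mul, hconj, eq_inv_mul_iff_mul_eq, ← mul_assoc, ← pow_add, two_mul]
    have hsnd : cs.simple j * (p ^ m * t * (p ^ m)⁻¹) * cs.simple j = cs.simple i ↔
        p ^ (2 * m + 1) * t = cs.simple j := by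
      have h : p ^ (2 * m + 1) * t = cs.simple j ↔
          p * (p ^ m * t * (p ^ m)⁻¹) = cs.simple j := by
        rw [show 2 * m + 1 = m + (1 + m) by ring, pow_add, mul_assoc, ← eq_inv_mul_iff_mul_eq,
          ← hconj, ← mul_inv_eq_iff_eq_mul, pow_add, pow_one]
        simp only [mul_assoc]
      rw [h, hp]
      constructor <;> intro h
      · simpa [mul_assoc] using congrArg (fun z ↦ cs.simple i * z * cs.simple j) h
      · simpa [mul_assoc] using congrArg (fun z ↦ cs.simple i * z * cs.simple j) h
    rw [pow_succ', show ((cs.signedConjSimple i * cs.signedConjSimple j) *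
        (cs.signedConjSimple i * cs.signedConjSimple j) ^ m) (t, ε) =
        cs.signedConjSimple i (cs.signedConjSimple j
          (((cs.signedConjSimple i * cs.signedConjSimple j) ^ m) (t, ε))) from rfl, ih]
    simp only [signedConjSimple, hfst, hsnd]
    rw [show 2 * (m + 1) = 2 * m + 1 + 1 by ring, Finset.sum_range_succ, Finset.sum_range_succ]
    refine Prod.ext ?_ ?_
    · simp [pow_succ', hp, mul_assoc]
    · simp only [add_assoc]

theorem isLiftable_signedConjSimple : M.IsLiftable cs.signedConjSimple := by
  classical
  intro i j
  funext ⟨t, ε⟩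
  rw [signedConjSimple_mul_pow_apply, two_mul, Finset.sum_range_add]
  simp only [pow_add, cs.simple_mul_simple_pow, one_mul]
  rw [CharTwo.add_self_eq_zero]
  simp [Function.End.one_def]

/-- The action of `W` on signed elements of `W` extending `signedConjSimple`. -/
noncomputable def signedConj : W →* Function.End (W × ZMod 2) :=
  cs.lift ⟨cs.signedConjSimple, cs.isLiftable_signedConjSimple⟩

theorem signedConj_simple (i : B) : cs.signedConj (cs.simple i) = cs.signedConjSimple i :=
  cs.lift_apply_simple cs.isLiftable_signedConjSimple i

open Classical in
theorem signedConj_wordProd_apply (ω : List B) (t : W) (ε : ZMod 2) :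
    cs.signedConj (cs.wordProd ω) (t, ε) =
      (cs.wordProd ω * t * (cs.wordProd ω)⁻¹, ε + (cs.rightInvSeq ω).count t) := by
  induction ω with
  | nil => simp [Function.End.one_def]
  | cons i ω ih =>
    rw [cs.wordProd_cons, map_mul, show (cs.signedConj (cs.simple i) *
      cs.signedConj (cs.wordProd ω)) (t, ε) = cs.signedConj (cs.simple i)
        (cs.signedConj (cs.wordProd ω) (t, ε)) from rfl, ih, signedConj_simple]
    have h : cs.wordProd ω * t * (cs.wordProd ω)⁻¹ = cs.simple i ↔
        (cs.wordProd ω)⁻¹ * cs.simple i * cs.wordProd ω = t := by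
      rw [mul_inv_eq_iff_eq_mul, ← eq_inv_mul_iff_mul_eq, mul_assoc, eq_comm]
    refine Prod.ext ?_ ?_
    · simp [signedConjSimple, mul_assoc]
    · simp [signedConjSimple, h, rightInvSeq, List.count_cons, add_assoc]

/-- The parity of the number of occurrences of `t` in the right inversion sequence of any word
for `w`. -/
noncomputable def inversionParity (w t : W) : ZMod 2 := (cs.signedConj w (t, 0)).2

theorem signedConj_apply (w t : W) (ε : ZMod 2) :
    cs.signedConj w (t, ε) = (w * t * w⁻¹, ε + cs.inversionParity w t) := by
  obtain ⟨ω, rfl⟩ := cs.wordProd_surjective w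
  simp [inversionParity, signedConj_wordProd_apply]

theorem inversionParity_mul (v w t : W) :
    cs.inversionParity (v * w) t =
      cs.inversionParity w t + cs.inversionParity v (w * t * w⁻¹) := by
  rw [inversionParity, map_mul, show (cs.signedConj v * cs.signedConj w) (t, 0) =
    cs.signedConj v (cs.signedConj w (t, 0)) from rfl, signedConj_apply, signedConj_apply, zero_add]

theorem inversionParity_one (t : W) : cs.inversionParity 1 t = 0 := by
  simp [inversionParity, Function.End.one_def]

theorem inversionParity_simple_self (i : B) :
    cs.inversionParity (cs.simple i) (cs.simple i) = 1 := by
  simp [inversionParity, signedConj_simple, signedConjSimple]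

theorem IsReflection.inversionParity_self {t : W} (ht : cs.IsReflection t) :
    cs.inversionParity t t = 1 := by
  obtain ⟨w, i, rfl⟩ := ht
  have h := cs.inversionParity_one (w * cs.simple i * w⁻¹)
  rw [← mul_inv_cancel w, inversionParity_mul] at h
  rw [inversionParity_mul, inversionParity_mul]
  simp only [inv_inv, mul_assoc, inv_mul_cancel_left, inv_mul_cancel, mul_one,
    one_mul, simple_mul_simple_self, inv_simple,
    inversionParity_simple_self] at h ⊢
  linear_combination h

theorem isRightInversion_of_inversionParity_ne_zero {w t : W}
    (h : cs.inversionParity w t ≠ 0) : cs.IsRightInversion w t := by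
  classical
  obtain ⟨ω, hω, rfl⟩ := cs.exists_isReduced w
  apply cs.isRightInversion_of_mem_rightInvSeq hω
  contrapose! h
  simp [inversionParity, signedConj_wordProd_apply, List.count_eq_zero_of_not_mem h]

theorem isRightInversion_iff_inversionParity_ne_zero {w t : W} (ht : cs.IsReflection t) :
    cs.IsRightInversion w t ↔ cs.inversionParity w t ≠ 0 := by
  refine ⟨fun h h0 ↦ ?_, cs.isRightInversion_of_inversionParity_ne_zero⟩
  refine (ht.isRightInversion_mul_left_iff.mp ?_) h
  apply cs.isRightInversion_of_inversionParity_ne_zero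
  rw [inversionParity_mul, ht.inversionParity_self, mul_inv_cancel_right, h0]
  simp

end CoxeterSystem

/-- Let `(W,S)` be a Coxeter system with length function `ℓ`.
If `s ∈ S` is a simple reflection and `x, y ∈ W` satisfy `ℓ(xs) > ℓ(x)` and
`ℓ(sy) > ℓ(y)`, then `ℓ(xsy) > ℓ(xy)`. -/
theorem length_mul_simple_mul_gt {B W : Type*} [Group W] {M : CoxeterMatrix B}
    (cs : CoxeterSystem M W) (i : B) (x y : W)
    (hx : cs.length (x * cs.simple i) > cs.length x)
    (hy : cs.length (cs.simple i * y) > cs.length y) :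
    cs.length (x * cs.simple i * y) > cs.length (x * y) := by
  have hs := cs.isReflection_simple i
  have ht : cs.IsReflection (y⁻¹ * cs.simple i * y) := by simpa using hs.conj y⁻¹
  have hx0 : cs.inversionParity x (cs.simple i) = 0 := by
    by_contra h
    exact hx.not_gt ((cs.isRightInversion_iff_inversionParity_ne_zero hs).mpr h).2
  have hy0 : cs.inversionParity y (y⁻¹ * cs.simple i * y) = 0 := by
    by_contra h
    have h' := ((cs.isRightInversion_iff_inversionParity_ne_zero ht).mpr h).2
    rw [← mul_assoc, mul_inv_cancel_left] at h'
    exact hy.not_gt h'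
  have hxy : cs.inversionParity (x * y) (y⁻¹ * cs.simple i * y) = 0 := by
    rw [cs.inversionParity_mul, hy0, ← mul_assoc, mul_inv_cancel_left, mul_inv_cancel_right, hx0,
      add_zero]
  have hprod : x * y * (y⁻¹ * cs.simple i * y) = x * cs.simple i * y := by group
  have hle : ¬ cs.length (x * y * (y⁻¹ * cs.simple i * y)) < cs.length (x * y) := fun h ↦
    (cs.isRightInversion_iff_inversionParity_ne_zero ht).mp ⟨ht, h⟩ hxy
  rw [← hprod]
  exact lt_of_le_of_ne (not_lt.mp hle) (ht.length_mul_left_ne (x * y)).symm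
end

section
/- Let (W,S) be a Coxeter system with S finite, with geometric realization σ : W → GL(E) and root system Φ = Φ⁺ ⊔ Φ⁻. Let s ∈ S, let x ∈ W with ℓ(xs) > ℓ(x), and let β ∈ Φ⁺ with β ≠ e_s be a positive root such that s.β − β = c·e_s for some real number c ≥ 0. Then s.β ∈ Φ_x implies β ∈ Φ_x. -/
/-- The symmetric bilinear form on `E = B → ℝ` attached to a Coxeter matrix `M`:
`(e_i, e_j) = -cos (π / m_{ij})`, interpreted as `-1` when `m_{ij} = 0` (infinite order). -/
noncomputable def geomForm {B : Type*} [Fintype B] (M : CoxeterMatrix B)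
    (f g : B → ℝ) : ℝ :=
  ∑ i, ∑ j, f i * g j *
    (if M i j = 0 then (-1 : ℝ) else -Real.cos (Real.pi / (M i j)))

/-- The set of roots `Φ = {x.e_s : x ∈ W, s ∈ S}` of the geometric realization `σ`. -/
def rootSet {B W : Type*} [DecidableEq B] [Group W]
    (σ : W →* ((B → ℝ) ≃ₗ[ℝ] (B → ℝ))) : Set (B → ℝ) :=
  {v | ∃ (w : W) (i : B), σ w (Pi.single i 1) = v}

/-- The set of positive roots `Φ⁺`: roots which are nonnegative linear combinations
of the basis vectors `e_s`. -/
def posRoots {B W : Type*} [DecidableEq B] [Group W]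
    (σ : W →* ((B → ℝ) ≃ₗ[ℝ] (B → ℝ))) : Set (B → ℝ) :=
  {v ∈ rootSet σ | ∀ i, 0 ≤ v i}

/-- The set of negative roots `Φ⁻ = -Φ⁺`. -/
def negRoots {B W : Type*} [DecidableEq B] [Group W]
    (σ : W →* ((B → ℝ) ≃ₗ[ℝ] (B → ℝ))) : Set (B → ℝ) :=
  {v | -v ∈ posRoots σ}

/-- The inversion set `Φ_x = {α ∈ Φ⁺ : x.α ∈ Φ⁻}`. -/
def invSet {B W : Type*} [DecidableEq B] [Group W]
    (σ : W →* ((B → ℝ) ≃ₗ[ℝ] (B → ℝ))) (x : W) : Set (B → ℝ) :=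
  {α ∈ posRoots σ | σ x α ∈ negRoots σ}

/-- The set `Φ_x⁻ = -Φ_x`. -/
def minusInvSet {B W : Type*} [DecidableEq B] [Group W]
    (σ : W →* ((B → ℝ) ≃ₗ[ℝ] (B → ℝ))) (x : W) : Set (B → ℝ) :=
  {v | -v ∈ invSet σ x}

open Polynomial in
/-- The action of an alternating word in two simple reflections on a simple root. -/
theorem apply_alternatingWord {B W : Type*} [DecidableEq B] [Group W]
    {M : CoxeterMatrix B} (cs : CoxeterSystem M W)
    (σ : W →* ((B → ℝ) ≃ₗ[ℝ] (B → ℝ))) (i j : B) (a : ℝ)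
    (hii : σ (cs.simple i) (Pi.single i 1) = -Pi.single i 1)
    (hjj : σ (cs.simple j) (Pi.single j 1) = -Pi.single j 1)
    (hij : σ (cs.simple i) (Pi.single j 1) = Pi.single j 1 + (2 * a) • Pi.single i 1)
    (hji : σ (cs.simple j) (Pi.single i 1) = Pi.single i 1 + (2 * a) • Pi.single j 1)
    (k : ℕ) :
    σ (cs.wordProd (CoxeterSystem.alternatingWord i j k)) (Pi.single i 1) =
      if Even k then
        (Chebyshev.U ℝ k).eval a • Pi.single i 1 + (Chebyshev.U ℝ (k - 1)).eval a • Pi.single j 1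
      else
        (Chebyshev.U ℝ (k - 1)).eval a • Pi.single i 1 + (Chebyshev.U ℝ k).eval a • Pi.single j 1 := by
  induction k with
  | zero => simp [CoxeterSystem.alternatingWord]
  | succ k ih =>
    have hU : (Chebyshev.U ℝ ((k + 1 : ℕ) : ℤ)).eval a =
        2 * a * (Chebyshev.U ℝ k).eval a - (Chebyshev.U ℝ (k - 1)).eval a := by
      push_cast
      rw [Chebyshev.U_add_one]
      simp
    rw [CoxeterSystem.alternatingWord_succ', cs.wordProd_cons, map_mul, LinearEquiv.mul_apply, ih,
      hU]
    by_cases hk : Even k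
    · simp only [hk, Nat.even_add_one, if_true, not_true, if_false, map_add, map_smul, hjj, hji]
      push_cast
      rw [add_sub_cancel_right]
      module
    · simp only [hk, Nat.even_add_one, if_true, not_false_iff, if_false, map_add, map_smul, hii,
        hij]
      push_cast
      rw [add_sub_cancel_right]
      module

theorem geomForm_single_single {B : Type*} [Fintype B] [DecidableEq B] (M : CoxeterMatrix B)
    (i j : B) :
    geomForm M (Pi.single i 1) (Pi.single j 1) =
      if M i j = 0 then (-1 : ℝ) else -Real.cos (Real.pi / (M i j)) := by
  have h (c : B → B → ℝ) : ∑ a, ∑ b,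
      (Pi.single i 1 : B → ℝ) a * (Pi.single j 1 : B → ℝ) b * c a b = c i j := by
    simp [Pi.single_apply]
  exact h _

theorem geomForm_single_self {B : Type*} [Fintype B] [DecidableEq B] (M : CoxeterMatrix B)
    (i : B) : geomForm M (Pi.single i 1) (Pi.single i 1) = 1 := by
  simp [geomForm_single_single]

theorem geomForm_single_comm {B : Type*} [Fintype B] [DecidableEq B] (M : CoxeterMatrix B)
    (i j : B) :
    geomForm M (Pi.single i 1) (Pi.single j 1) = geomForm M (Pi.single j 1) (Pi.single i 1) := by
  simp only [geomForm_single_single, M.symmetric i j]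

open Polynomial in
theorem chebyshev_U_eval_neg_geomForm_nonneg {B : Type*} [Fintype B] [DecidableEq B]
    (M : CoxeterMatrix B) {i j : B} (hij : i ≠ j) (n : ℕ) (hn : M i j = 0 ∨ n ≤ M i j) :
    0 ≤ (Chebyshev.U ℝ (n - 1)).eval (-geomForm M (Pi.single i 1) (Pi.single j 1)) := by
  rw [geomForm_single_single]
  split_ifs with h
  · simp
  · have hn : n ≤ M i j := hn.resolve_left h
    have hM : 2 ≤ M i j := by
      have := M.off_diagonal i j hij
      omega
    have hM' : (2 : ℝ) ≤ M i j := by exact_mod_cast hM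
    have hpos : 0 < Real.sin (Real.pi / M i j) := by
      apply Real.sin_pos_of_pos_of_lt_pi (by positivity)
      exact div_lt_self Real.pi_pos (by linarith)
    have hnonneg : 0 ≤ Real.sin (n * (Real.pi / M i j)) := by
      apply Real.sin_nonneg_of_nonneg_of_le_pi (by positivity)
      rw [← mul_div_assoc, div_le_iff₀ (by positivity), mul_comm]
      gcongr
    have := Chebyshev.U_real_cos (Real.pi / M i j) (n - 1)
    push_cast at this
    rw [sub_add_cancel] at this
    rw [neg_neg]
    exact nonneg_of_mul_nonneg_left (this ▸ hnonneg) hpos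

/-- An element `w` having `j` but not `i` as a right descent factors as `v * u` with `u` alternating
in `i` and `j`, the lengths adding up, and `v` of minimal length in its coset. -/
theorem exists_eq_mul_alternatingWord {B W : Type*} [Group W]
    {M : CoxeterMatrix B} (cs : CoxeterSystem M W) {i j : B} {w : W}
    (hj : cs.IsRightDescent w j) (hi : ¬ cs.IsRightDescent w i) :
    ∃ (v : W) (k : ℕ), w = v * cs.wordProd (CoxeterSystem.alternatingWord i j k) ∧
      cs.length v < cs.length w ∧ (M i j = 0 ∨ k < M i j) ∧
      ¬ cs.IsRightDescent v i ∧ ¬ cs.IsRightDescent v j := by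
  let P : ℕ → Prop := fun k ↦ ∃ v, w = v * cs.wordProd (CoxeterSystem.alternatingWord i j k) ∧
    cs.length w = cs.length v + k
  have hP1 : P 1 := by
    refine ⟨w * cs.simple j, by simp [CoxeterSystem.alternatingWord], ?_⟩
    rw [cs.isRightDescent_iff] at hj
    exact hj.symm
  obtain ⟨k, ⟨v, hwv, hlen⟩, hk⟩ : ∃ k, P (k + 1) ∧ ¬ P (k + 2) := by
    by_contra! h
    have hP : ∀ k, P (k + 1) := fun k ↦ by
      induction k with
      | zero => exact hP1
      | succ k ih => exact h k ih
    obtain ⟨v, -, hv⟩ := hP (cs.length w)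
    omega
  have hfirst : ¬ cs.IsRightDescent v (if Even k then j else i) := by
    intro h
    rw [cs.isRightDescent_iff] at h
    have hle := cs.length_mul_le (v * cs.simple (if Even k then j else i))
      (cs.wordProd (CoxeterSystem.alternatingWord i j k))
    have := cs.length_wordProd_le (CoxeterSystem.alternatingWord i j k)
    rw [CoxeterSystem.length_alternatingWord] at this
    rw [CoxeterSystem.alternatingWord_succ', cs.wordProd_cons, ← mul_assoc] at hwv
    rw [← hwv] at hle
    omega
  have hnext : ¬ cs.IsRightDescent v (if Even (k + 1) then j else i) := by
    intro h
    rw [cs.isRightDescent_iff] at h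
    refine hk ⟨v * cs.simple (if Even (k + 1) then j else i), ?_, by omega⟩
    rw [CoxeterSystem.alternatingWord_succ' i j (k + 1), cs.wordProd_cons, ← mul_assoc,
      cs.simple_mul_simple_cancel_right, hwv]
  refine ⟨v, k + 1, hwv, by omega, ?_, ?_⟩
  · by_contra! hM
    obtain ⟨hM0, hMk⟩ := hM
    have hred : ¬ M i j < k + 1 := fun hlt ↦ by
      refine cs.not_isReduced_alternatingWord i j hM0 hlt ?_
      have hle := cs.length_mul_le v (cs.wordProd (CoxeterSystem.alternatingWord i j (k + 1)))
      have := cs.length_wordProd_le (CoxeterSystem.alternatingWord i j (k + 1))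
      rw [← hwv] at hle
      rw [CoxeterSystem.length_alternatingWord] at this
      rw [CoxeterSystem.IsReduced, CoxeterSystem.length_alternatingWord]
      omega
    have hMeq : M j i = k + 1 := by
      rw [M.symmetric]
      omega
    have hmul : w * cs.simple i = v * cs.wordProd (CoxeterSystem.alternatingWord i j k) := by
      rw [hwv, mul_assoc, ← cs.wordProd_concat, ← CoxeterSystem.alternatingWord_succ,
        cs.prod_alternatingWord_eq_prod_alternatingWord_sub j i _ (by omega), hMeq]
      congr 3
      omega
    have hle := cs.length_mul_le v (cs.wordProd (CoxeterSystem.alternatingWord i j k))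
    have := cs.length_wordProd_le (CoxeterSystem.alternatingWord i j k)
    rw [CoxeterSystem.length_alternatingWord] at this
    rw [← hmul] at hle
    exact hi (show cs.length (w * cs.simple i) < cs.length w by omega)
  · by_cases hk' : Even k <;> simp_all [Nat.even_add_one]

/-- If `i` is not a right descent of `w`, then `w` maps the simple root `e_i` to a vector with
nonnegative coordinates. -/
theorem apply_single_nonneg_of_not_isRightDescent {B W : Type*} [Fintype B] [DecidableEq B]
    [Group W] {M : CoxeterMatrix B} (cs : CoxeterSystem M W)
    (σ : W →* ((B → ℝ) ≃ₗ[ℝ] (B → ℝ)))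
    (hσ : ∀ (i : B) (e : B → ℝ),
      σ (cs.simple i) e = e - (2 * geomForm M e (Pi.single i 1)) • (Pi.single i 1 : B → ℝ))
    (w : W) (i : B) (hi : ¬ cs.IsRightDescent w i) :
    0 ≤ σ w (Pi.single i 1) := by
  induction hn : cs.length w using Nat.strong_induction_on generalizing w i with
  | _ n ih =>
    subst hn
    by_cases hw : w = 1
    · subst hw
      simp
    obtain ⟨j, hj⟩ := cs.exists_rightDescent_of_ne_one hw
    have hij : i ≠ j := by
      rintro rfl
      exact hi hj
    obtain ⟨v, k, hwv, hlt, hkM, hvi, hvj⟩ := exists_eq_mul_alternatingWord cs hj hi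
    have hi0 := ih _ hlt v i hvi rfl
    have hj0 := ih _ hlt v j hvj rfl
    have hself (l : B) : σ (cs.simple l) (Pi.single l 1) = -Pi.single l 1 := by
      rw [hσ, geomForm_single_self]
      module
    have hU := chebyshev_U_eval_neg_geomForm_nonneg M hij k (hkM.imp_right le_of_lt)
    have hU' := chebyshev_U_eval_neg_geomForm_nonneg M hij (k + 1) (hkM.imp_right Nat.succ_le_of_lt)
    push_cast at hU'
    rw [add_sub_cancel_right] at hU'
    rw [hwv, map_mul, LinearEquiv.mul_apply, apply_alternatingWord cs σ i j
      (-geomForm M (Pi.single i 1) (Pi.single j 1)) (hself i) (hself j)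
      (by rw [hσ, geomForm_single_comm]; module) (by rw [hσ]; module)]
    split_ifs
    all_goals
      rw [map_add, map_smul, map_smul]
      positivity

/-- Roots are stable under negation. -/
theorem neg_mem_rootSet {B W : Type*} [Fintype B] [DecidableEq B] [Group W]
    {M : CoxeterMatrix B} (cs : CoxeterSystem M W)
    (σ : W →* ((B → ℝ) ≃ₗ[ℝ] (B → ℝ)))
    (hσ : ∀ (i : B) (e : B → ℝ),
      σ (cs.simple i) e = e - (2 * geomForm M e (Pi.single i 1)) • (Pi.single i 1 : B → ℝ))
    {v : B → ℝ} (hv : v ∈ rootSet σ) : -v ∈ rootSet σ := by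
  obtain ⟨w, i, rfl⟩ := hv
  refine ⟨w * cs.simple i, i, ?_⟩
  rw [map_mul, LinearEquiv.mul_apply, hσ, geomForm_single_self, ← map_neg]
  congr 1
  module

/-- Roots are stable under the action of the group. -/
theorem apply_mem_rootSet {B W : Type*} [DecidableEq B] [Group W]
    (σ : W →* ((B → ℝ) ≃ₗ[ℝ] (B → ℝ))) (x : W) {v : B → ℝ} (hv : v ∈ rootSet σ) :
    σ x v ∈ rootSet σ := by
  obtain ⟨w, i, rfl⟩ := hv
  exact ⟨x * w, i, by rw [map_mul, LinearEquiv.mul_apply]⟩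

/-- Let `s ∈ S`, let `x ∈ W` with `ℓ(xs) > ℓ(x)`, and let
`β ∈ Φ⁺` with `β ≠ e_s` be such that `s.β − β = c • e_s` for some real `c ≥ 0`.
Then `s.β ∈ Φ_x` implies `β ∈ Φ_x`. -/
theorem mem_invSet_of_simple_smul_mem
    {B W : Type*} [Fintype B] [DecidableEq B] [Group W]
    {M : CoxeterMatrix B} (cs : CoxeterSystem M W)
    (σ : W →* ((B → ℝ) ≃ₗ[ℝ] (B → ℝ)))
    (hσ : ∀ (i : B) (e : B → ℝ),
      σ (cs.simple i) e = e - (2 * geomForm M e (Pi.single i 1)) • (Pi.single i 1 : B → ℝ))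
    (i : B) (x : W)
    (hx : cs.length (x * cs.simple i) > cs.length x)
    (β : B → ℝ) (hβpos : β ∈ posRoots σ) (hβne : β ≠ (Pi.single i 1 : B → ℝ))
    (c : ℝ) (hc : 0 ≤ c)
    (hcβ : σ (cs.simple i) β - β = c • (Pi.single i 1 : B → ℝ))
    (hmem : σ (cs.simple i) β ∈ invSet σ x) :
    β ∈ invSet σ x := by
  have hnonneg := apply_single_nonneg_of_not_isRightDescent cs σ hσ x i (not_lt.mpr hx.le)
  refine ⟨hβpos, neg_mem_rootSet cs σ hσ (apply_mem_rootSet σ x hβpos.1), fun b ↦ ?_⟩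
  have hneg := hmem.2.2 b
  have hxβ : -σ x β = -σ x (σ (cs.simple i) β) + c • σ x (Pi.single i 1) := by
    rw [← map_smul, ← hcβ, map_sub]
    abel
  rw [hxβ]
  exact add_nonneg hneg (mul_nonneg hc (hnonneg b))
end

section
/- Let n ≥ 2 and let m be an integer coprime to n. Let λ : ℤ/nℤ → ℤ be any function and define μ : ℤ/nℤ → ℤ by μ(i) := λ(i+m) − λ(i). Then 2·Σ_{i,j ∈ ℤ/nℤ} |λ(i) − λ(j)| ≤ (n−1)·Σ_{i,j ∈ ℤ/nℤ} |μ(i) − μ(j)|, where each sum runs over all ordered pairs (i,j). -/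
/-- A shift by `k • g` displaces `f` in total at most `k` times as much as a shift by `g`. -/
theorem sum_abs_shift_nsmul_le {G : Type*} [AddCommGroup G] [Fintype G] (f : G → ℤ) (g : G)
    (k : ℕ) : ∑ i, |f (i + k • g) - f i| ≤ k * ∑ i, |f (i + g) - f i| := by
  induction k with
  | zero => simp
  | succ k ih =>
    have h : ∑ i, |f (i + k • g + g) - f (i + k • g)| = ∑ i, |f (i + g) - f i| :=
      Equiv.sum_comp (Equiv.addRight (k • g)) fun i => |f (i + g) - f i|
    calc ∑ i, |f (i + (k + 1) • g) - f i|
        ≤ ∑ i, (|f (i + k • g + g) - f (i + k • g)| + |f (i + k • g) - f i|) := by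
          gcongr with i
          rw [succ_nsmul, ← add_assoc]
          exact abs_sub_le _ _ _
      _ ≤ (k + 1 : ℕ) * ∑ i, |f (i + g) - f i| := by
          rw [Finset.sum_add_distrib, h]
          push_cast
          linarith

theorem sum_abs_shift_neg {G : Type*} [AddCommGroup G] [Fintype G] (f : G → ℤ) (g : G) :
    ∑ i, |f (i + -g) - f i| = ∑ i, |f (i + g) - f i| := by
  rw [← Equiv.sum_comp (Equiv.addRight g) fun i => |f (i + -g) - f i|]
  simp [abs_sub_comm]

/-- If `n • g = 0` and `k ≤ n`, then going around the cycle in the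
shorter direction bounds the displacement by `n / 2` steps. -/
theorem two_mul_sum_abs_shift_le {G : Type*} [AddCommGroup G] [Fintype G] (f : G → ℤ) (g : G)
    {n k : ℕ} (hk : k ≤ n) (hg : n • g = 0) :
    2 * ∑ i, |f (i + k • g) - f i| ≤ n * ∑ i, |f (i + g) - f i| := by
  have h₁ := sum_abs_shift_nsmul_le f g k
  have h₂ := sum_abs_shift_nsmul_le f g (n - k)
  rw [sub_nsmul g hk, hg, zero_add, sum_abs_shift_neg, Nat.cast_sub hk] at h₂
  linarith

theorem card_mul_sum_abs_le {ι : Type*} [Fintype ι] (f : ι → ℤ) (hf : ∑ i, f i = 0) :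
    Fintype.card ι * ∑ i, |f i| ≤ ∑ i, ∑ j, |f i - f j| := by
  rw [Finset.mul_sum]
  gcongr with i
  calc (Fintype.card ι : ℤ) * |f i| = |∑ j, (f i - f j)| := by
        simp [Finset.sum_sub_distrib, hf, abs_mul]
    _ ≤ ∑ j, |f i - f j| := Finset.abs_sum_le_sum_abs _ _

/-- Let `n ≥ 2` and let `m` be an integer coprime to `n`.  Let
`λ : ℤ/nℤ → ℤ` and define `μ : ℤ/nℤ → ℤ` by `μ(i) := λ(i+m) − λ(i)`.  Then
`2·Σ_{i,j} |λ(i) − λ(j)| ≤ (n−1)·Σ_{i,j} |μ(i) − μ(j)|`. -/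
theorem two_sum_abs_le {n : ℕ} [NeZero n] (hn : 2 ≤ n)
    (m : ℤ) (hm : IsCoprime m (n : ℤ))
    (lam : ZMod n → ℤ) (mu : ZMod n → ℤ)
    (hmu : ∀ i : ZMod n, mu i = lam (i + (m : ZMod n)) - lam i) :
    2 * ∑ i : ZMod n, ∑ j : ZMod n, |lam i - lam j| ≤
      ((n : ℤ) - 1) * ∑ i : ZMod n, ∑ j : ZMod n, |mu i - mu j| := by
  obtain rfl : mu = fun i => lam (i + (m : ZMod n)) - lam i := funext hmu
  have hT := card_mul_sum_abs_le (fun i => lam (i + (m : ZMod n)) - lam i) (by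
    rw [Finset.sum_sub_distrib, sub_eq_zero]
    exact Equiv.sum_comp (Equiv.addRight (m : ZMod n)) lam)
  rw [ZMod.card] at hT
  set D := ∑ i, |lam (i + (m : ZMod n)) - lam i|
  have hshift (c : ZMod n) : 2 * ∑ i, |lam (i + c) - lam i| ≤ n * D := by
    obtain ⟨a, b, hab⟩ := hm
    have hc : (c * (a : ZMod n)).val • (m : ZMod n) = c := by
      have h := congrArg (Int.cast : ℤ → ZMod n) hab
      push_cast at h
      rw [ZMod.natCast_self, mul_zero, add_zero] at h
      rw [nsmul_eq_mul, ZMod.natCast_zmod_val, mul_assoc, h, mul_one]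
    have h := two_mul_sum_abs_shift_le lam (m : ZMod n) (ZMod.val_lt (c * (a : ZMod n))).le
      (by simp)
    rwa [hc] at h
  calc 2 * ∑ i, ∑ j, |lam i - lam j|
      = ∑ c : ZMod n, 2 * ∑ i, |lam (i + c) - lam i| := by
        rw [← Finset.mul_sum, Finset.sum_comm]
        congr 1
        rw [Finset.sum_comm (f := fun c i => |lam (i + c) - lam i|)]
        refine Finset.sum_congr rfl fun i _ => ?_
        exact (Equiv.sum_comp (Equiv.addLeft i) fun j => |lam j - lam i|).symm
    _ = ∑ c ∈ Finset.univ.erase (0 : ZMod n), 2 * ∑ i, |lam (i + c) - lam i| :=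
        (Finset.sum_erase _ (by simp)).symm
    _ ≤ ∑ c ∈ Finset.univ.erase (0 : ZMod n), n * D := Finset.sum_le_sum fun c _ => hshift c
    _ = ((n : ℤ) - 1) * (n * D) := by
        simp [Finset.card_erase_of_mem, ZMod.card, Nat.cast_sub (show 1 ≤ n by omega)]
    _ ≤ _ := mul_le_mul_of_nonneg_left hT (by omega)
end
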